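/- arXiv:2205.13252 — 2 statements merged into one kernel-verified Lean document; each statement's English description precedes it below -/
import Mathlib

section
/- Let R be a commutative ring, a ∈ R, t a positive integer. The assignment M ↦ a^t·Γ_a(M) is a preradical: for every R-linear map f : M → N, f(a^t·Γ_a(M)) ⊆ a^t·Γ_a(N). Moreover it is a radical: a^t·Γ_a(M / a^t·Γ_a(M)) = 0 for every R-module M. -/
open Pointwise

/-- The `a`-torsion submodule `Γ_a(M) = {m | ∃ k ≥ 1, a^k • m = 0}`. -/
def aTorsion (R : Type*) [CommRing R] (a : R) (M : Type*) [AddCommGroup M]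
    [Module R M] : Submodule R M :=
  ⨆ k : ℕ, Submodule.torsionBy R M (a ^ (k + 1))

/-- The generalised locally nilradical `a^t • Γ_a(M)`. -/
def genLocNil (R : Type*) [CommRing R] (a : R) (t : ℕ) (M : Type*)
    [AddCommGroup M] [Module R M] : Submodule R M :=
  a ^ t • aTorsion R a M

universe u

theorem mem_aTorsion_iff {R M : Type*} [CommRing R] [AddCommGroup M] [Module R M] {a : R}
    {m : M} : m ∈ aTorsion R a M ↔ ∃ k : ℕ, a ^ (k + 1) • m = 0 := by
  have hmono : Monotone fun k : ℕ => Submodule.torsionBy R M (a ^ (k + 1)) := fun i j hij =>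
    Submodule.torsionBy_le_torsionBy_of_dvd _ _ (pow_dvd_pow a (Nat.succ_le_succ hij))
  simp [aTorsion, Submodule.mem_iSup_of_directed _ hmono.directed_le]

theorem mem_genLocNil_iff {R M : Type*} [CommRing R] [AddCommGroup M] [Module R M] {a : R}
    {t : ℕ} {m : M} : m ∈ genLocNil R a t M ↔ ∃ x ∈ aTorsion R a M, a ^ t • x = m :=
  Submodule.mem_smul_pointwise_iff_exists _ _ _

theorem genLocNil_le_aTorsion {R M : Type*} [CommRing R] [AddCommGroup M] [Module R M] {a : R}
    {t : ℕ} : genLocNil R a t M ≤ aTorsion R a M := by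
  intro m hm
  obtain ⟨x, hx, rfl⟩ := mem_genLocNil_iff.1 hm
  exact Submodule.smul_mem _ _ hx

theorem mem_aTorsion_of_pow_smul_mem {R M : Type*} [CommRing R] [AddCommGroup M] [Module R M]
    {a : R} {m : M} {k : ℕ} (h : a ^ k • m ∈ aTorsion R a M) : m ∈ aTorsion R a M := by
  obtain ⟨l, hl⟩ := mem_aTorsion_iff.1 h
  refine mem_aTorsion_iff.2 ⟨l + k, ?_⟩
  rw [← hl, smul_smul, ← pow_add, Nat.add_right_comm]

/-- `M ↦ a^t • Γ_a(M)` is a preradical, and moreover a radical. -/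
theorem stmt_16 {R : Type u} [CommRing R] (a : R) (t : ℕ) (ht : 1 ≤ t) :
    (∀ (M N : Type u) [AddCommGroup M] [Module R M] [AddCommGroup N]
      [Module R N] (f : M →ₗ[R] N),
      Submodule.map f (genLocNil R a t M) ≤ genLocNil R a t N) ∧
    (∀ (M : Type u) [AddCommGroup M] [Module R M],
      genLocNil R a t (M ⧸ genLocNil R a t M) = ⊥) := by
  refine ⟨fun M N _ _ _ _ f => ?_, fun M _ _ => ?_⟩
  · rintro _ ⟨m, hm, rfl⟩
    obtain ⟨x, hx, rfl⟩ := mem_genLocNil_iff.1 hm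
    obtain ⟨k, hk⟩ := mem_aTorsion_iff.1 hx
    refine mem_genLocNil_iff.2 ⟨f x, mem_aTorsion_iff.2 ⟨k, ?_⟩, (f.map_smul _ _).symm⟩
    rw [← f.map_smul, hk, f.map_zero]
  · refine (Submodule.eq_bot_iff _).2 fun y hy => ?_
    obtain ⟨x, hx, rfl⟩ := mem_genLocNil_iff.1 hy
    obtain ⟨m, rfl⟩ := Submodule.Quotient.mk_surjective _ x
    obtain ⟨k, hk⟩ := mem_aTorsion_iff.1 hx
    rw [← Submodule.Quotient.mk_smul, Submodule.Quotient.mk_eq_zero] at hk ⊢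
    exact mem_genLocNil_iff.2
      ⟨m, mem_aTorsion_of_pow_smul_mem (genLocNil_le_aTorsion hk), rfl⟩
end

section
/- Let R be a commutative ring, a ∈ R, t a positive integer, and {M_i}_{i∈I} a family of R-modules. Then a^t·Γ_a(⊕_{i∈I} M_i) = ⊕_{i∈I} a^t·Γ_a(M_i), and a^t·Γ_a(∏_{i∈I} M_i) ⊆ ∏_{i∈I} a^t·Γ_a(M_i). In particular, a product of a^t-reduced modules is a^t-reduced. -/
open Pointwise DirectSum

theorem aTorsion_le_comap {R M N : Type*} [CommRing R] (a : R) [AddCommGroup M] [Module R M]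
    [AddCommGroup N] [Module R N] (f : M →ₗ[R] N) :
    aTorsion R a M ≤ (aTorsion R a N).comap f := by
  refine iSup_le fun k y hy => Submodule.mem_iSup_of_mem k ?_
  rw [Submodule.mem_torsionBy_iff] at hy ⊢
  rw [← map_smul, hy, map_zero]

theorem map_mem_genLocNil {R M N : Type*} [CommRing R] (a : R) (t : ℕ) [AddCommGroup M]
    [Module R M] [AddCommGroup N] [Module R N] (f : M →ₗ[R] N) {x : M}
    (hx : x ∈ genLocNil R a t M) : f x ∈ genLocNil R a t N := by
  obtain ⟨y, hy, rfl⟩ := (Submodule.mem_smul_pointwise_iff_exists _ _ _).1 hx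
  rw [map_smul]
  exact Submodule.smul_mem_pointwise_smul _ _ _ (aTorsion_le_comap a f hy)

/-- `a^t • Γ_a(⊕ᵢ Mᵢ) = ⊕ᵢ a^t • Γ_a(Mᵢ)`,
`a^t • Γ_a(∏ᵢ Mᵢ) ⊆ ∏ᵢ a^t • Γ_a(Mᵢ)`, and a product of `a^t`-reduced modules
is `a^t`-reduced. -/
theorem stmt_18 {R : Type*} [CommRing R] (a : R) (t : ℕ) (ht : 1 ≤ t)
    {ι : Type*} [DecidableEq ι] (M : ι → Type*) [∀ i, AddCommGroup (M i)]
    [∀ i, Module R (M i)] :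
    (∀ x : ⨁ i, M i,
      x ∈ genLocNil R a t (⨁ i, M i) ↔ ∀ i, x i ∈ genLocNil R a t (M i)) ∧
    (∀ x : ∀ i, M i,
      x ∈ genLocNil R a t (∀ i, M i) → ∀ i, x i ∈ genLocNil R a t (M i)) ∧
    ((∀ i, genLocNil R a t (M i) = ⊥) → genLocNil R a t (∀ i, M i) = ⊥) := by
  have pi_apply_mem : ∀ x : ∀ i, M i,
      x ∈ genLocNil R a t (∀ i, M i) → ∀ i, x i ∈ genLocNil R a t (M i) :=
    fun x hx i => map_mem_genLocNil a t (LinearMap.proj i) hx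
  refine ⟨fun x => ⟨fun hx i => map_mem_genLocNil a t (DirectSum.component R ι M i) hx,
    fun hx => ?_⟩, pi_apply_mem, fun h => ?_⟩
  · classical
    rw [← DirectSum.sum_support_of x]
    exact Submodule.sum_mem _ fun i _ => map_mem_genLocNil a t (DirectSum.lof R ι M i) (hx i)
  · refine (Submodule.eq_bot_iff _).2 fun x hx => funext fun i => ?_
    simpa [h i] using pi_apply_mem x hx i
end
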